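/- Let n ≥ 1 and let λ be a B-partition of n, with d(λ) = ((λ^t)^−)_C. Then μ(λ) ⊆ d(λ), and both μ(λ) and d(λ) ∖ μ(λ) are special C-partitions (specialness in the e-count sense). -/

import Mathlib

namespace WFPaper

/-- The list of parts of a partition (multiset of positive integers) in weakly
decreasing order. -/
def sortedDesc (s : Multiset ℕ) : List ℕ := (s.sort (· ≤ ·)).reverse

/-- The `j`-th largest part of `s` (1-indexed); `0` if `j = 0` or `j > #s`. -/
def part (s : Multiset ℕ) (j : ℕ) : ℕ := (sortedDesc s).getD (j - 1) 0

/-- The smallest part of `s` (`0` if `s` is empty). -/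
def minPart (s : Multiset ℕ) : ℕ := (s.sort (· ≤ ·)).getD 0 0

/-- Sum of the `j` largest parts of `s`. -/
def psum (s : Multiset ℕ) (j : ℕ) : ℕ := ((sortedDesc s).take j).sum

/-- Dominance order: `DomLE a b` means `a ≤ b` in the dominance order, i.e.
for every `j` the sum of the `j` largest parts of `a` is at most that of `b`. -/
def DomLE (a b : Multiset ℕ) : Prop := ∀ j, psum a j ≤ psum b j

/-- All parts are positive. -/
def PosParts (s : Multiset ℕ) : Prop := ∀ x ∈ s, 0 < x

/-- A partition of an odd number in which every even part has even multiplicity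
(a B-partition of `n` when the sum is `2*n+1`). -/
def IsTypeB (s : Multiset ℕ) : Prop :=
  PosParts s ∧ Odd s.sum ∧ ∀ x, Even x → Even (s.count x)

/-- A partition of an even number in which every odd part has even multiplicity
(a C-partition of `n` when the sum is `2*n`). -/
def IsTypeC (s : Multiset ℕ) : Prop :=
  PosParts s ∧ Even s.sum ∧ ∀ x, Odd x → Even (s.count x)

/-- A partition of an even number in which every even part has even multiplicity
(a D-partition of `n` when the sum is `2*n`). -/
def IsTypeD (s : Multiset ℕ) : Prop :=
  PosParts s ∧ Even s.sum ∧ ∀ x, Even x → Even (s.count x)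

/-- `IsCollapse T α β` : `β` is the dominance-largest partition of class `T` of
the same number as `α` which is dominated by `α` (e.g. the B/C/D-collapse of `α`
for `T = IsTypeB/IsTypeC/IsTypeD`). -/
def IsCollapse (T : Multiset ℕ → Prop) (α β : Multiset ℕ) : Prop :=
  T β ∧ β.sum = α.sum ∧ DomLE β α ∧
    ∀ γ, T γ → γ.sum = α.sum → DomLE γ α → DomLE γ β

/-- The transpose (conjugate) partition: its `j`-th part (0-indexed `j`) is the
number of parts of `s` that are `≥ j+1`. -/
def transpose (s : Multiset ℕ) : Multiset ℕ :=
  (Multiset.range (part s 1)).map (fun j => (s.filter (fun x => j + 1 ≤ x)).card)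

/-- `λ⁻` : subtract 1 from the smallest part (the part being deleted if it
becomes 0). -/
def decMin (s : Multiset ℕ) : Multiset ℕ :=
  ((minPart s - 1) ::ₘ s.erase (minPart s)).filter (fun x => 0 < x)

/-- `λ⁺` : add 1 to the largest part. -/
def incMax (s : Multiset ℕ) : Multiset ℕ :=
  (part s 1 + 1) ::ₘ s.erase (part s 1)

/-- The subpartition `μ` of `T` whose multiplicity at an even `x` is 2 if
`m_T(x)` is even and nonzero, 1 if `m_T(x)` is odd, and 0 at odd `x`. -/
def muEven (T : Multiset ℕ) : Multiset ℕ :=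
  (T.toFinset.filter (fun x => Even x)).val.bind
    (fun x => Multiset.replicate (if Even (T.count x) then 2 else 1) x)

/-- The subpartition `μ` of `T` whose multiplicity at an odd `x` is 2 if
`m_T(x)` is even and nonzero, 1 if `m_T(x)` is odd, and 0 at even `x`. -/
def muOdd (T : Multiset ℕ) : Multiset ℕ :=
  (T.toFinset.filter (fun x => Odd x)).val.bind
    (fun x => Multiset.replicate (if Even (T.count x) then 2 else 1) x)

/-- The subpartition `π` of `T` consisting of the even parts of `T` of odd
multiplicity, each taken once. -/
def piEven (T : Multiset ℕ) : Multiset ℕ :=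
  (T.toFinset.filter (fun x => Even x ∧ Odd (T.count x))).val

/-- `k` is a (1-indexed) position of an odd part of `s`. -/
def OddIdx (s : Multiset ℕ) (k : ℕ) : Prop := 1 ≤ k ∧ Odd (part s k)

/-- `k` is a (1-indexed) position of an even part of `s`. -/
def EvenIdx (s : Multiset ℕ) (k : ℕ) : Prop :=
  1 ≤ k ∧ k ≤ Multiset.card s ∧ Even (part s k)

/-- `e_s(i,j)` : number of positions `i ≤ k ≤ j` with `s_k` even. -/
def eCount (s : Multiset ℕ) (i j : ℕ) : ℕ :=
  ((Finset.Icc i j).filter (fun k => Even (part s k))).card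

/-- number of positions `i ≤ k ≤ j` with `s_k` odd. -/
def oCount (s : Multiset ℕ) (i j : ℕ) : ℕ :=
  ((Finset.Icc i j).filter (fun k => Odd (part s k))).card

/-- `s` is special in the e-count sense: `e_s(1,t₁)` is even, and
`e_s(tᵢ,tᵢ₊₁)` is even for all `1 ≤ i ≤ p-1`, where `t₁ < ⋯ < t_p` are the
positions of the odd parts of `s`. -/
def IsSpecialE (s : Multiset ℕ) : Prop :=
  (∀ t, OddIdx s t → (∀ t', OddIdx s t' → t ≤ t') → Even (eCount s 1 t)) ∧
  (∀ i j, OddIdx s i → OddIdx s j → i < j →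
    (∀ k, OddIdx s k → k ≤ i ∨ j ≤ k) → Even (eCount s i j))

/-- `s` is quasi-special: `e_s(1,t₁)` is even, `e_s(tᵢ,tᵢ₊₁)` is even for all
`1 ≤ i ≤ p-2`, and the smallest part of `s` is odd with multiplicity 1. -/
def IsQuasiSpecialE (s : Multiset ℕ) : Prop :=
  (∀ t, OddIdx s t → (∀ t', OddIdx s t' → t ≤ t') → Even (eCount s 1 t)) ∧
  (∀ i j, OddIdx s i → OddIdx s j → i < j →
    (∀ k, OddIdx s k → k ≤ i ∨ j ≤ k) → (∃ k, OddIdx s k ∧ j < k) →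
      Even (eCount s i j)) ∧
  Odd (minPart s) ∧ s.count (minPart s) = 1

/-- Number of odd parts greater than every even part (equals the number of odd
parts greater than the largest even part, and the number of all odd parts if
there are no even parts). -/
def numOddDominant (s : Multiset ℕ) : ℕ :=
  (s.filter (fun x => Odd x ∧ ∀ y ∈ s, Even y → y < x)).card

/-- Between every pair of consecutive even parts of `s` (in the decreasing
listing of the parts) there is an even number of odd parts. -/
def EvenBetween (s : Multiset ℕ) : Prop :=
  ∀ i j, EvenIdx s i → EvenIdx s j → i < j →
    (∀ k, EvenIdx s k → k ≤ i ∨ j ≤ k) → Even (oCount s i j)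

/-- A special B-partition. -/
def IsSpecialTypeB (s : Multiset ℕ) : Prop :=
  IsTypeB s ∧ EvenBetween s ∧ Odd (numOddDominant s)

/-- A special D-partition. -/
def IsSpecialTypeD (s : Multiset ℕ) : Prop :=
  IsTypeD s ∧ EvenBetween s ∧ Even (numOddDominant s)

theorem coe_sortedDesc (s : Multiset ℕ) : (sortedDesc s : Multiset ℕ) = s := by
  rw [sortedDesc, Multiset.coe_reverse, Multiset.sort_eq]

theorem sortedDesc_pairwise (s : Multiset ℕ) : (sortedDesc s).Pairwise (· ≥ ·) := by
  rw [sortedDesc, List.pairwise_reverse]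
  exact s.pairwise_sort (· ≤ ·)

theorem length_sortedDesc (s : Multiset ℕ) : (sortedDesc s).length = s.card := by
  rw [← Multiset.coe_card, coe_sortedDesc]

theorem sortedDesc_coe {L : List ℕ} (h : L.Pairwise (· ≥ ·)) : sortedDesc (L : Multiset ℕ) = L :=
  List.Perm.eq_of_pairwise (fun _ _ _ _ h₁ h₂ => le_antisymm h₂ h₁) (sortedDesc_pairwise _) h
    (Multiset.coe_eq_coe.mp (coe_sortedDesc _))

theorem part_succ (s : Multiset ℕ) (i : ℕ) : part s (i + 1) = (sortedDesc s).getD i 0 := rfl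

theorem part_eq_zero {s : Multiset ℕ} {i : ℕ} (h : s.card ≤ i) : part s (i + 1) = 0 := by
  rw [part_succ, List.getD_eq_default]
  rwa [length_sortedDesc]

theorem antitone_part (s : Multiset ℕ) : Antitone (fun i => part s (i + 1)) := by
  intro i j hij
  rcases lt_or_ge j s.card with hj | hj
  · have hj' : j < (sortedDesc s).length := by rwa [length_sortedDesc]
    simp only [part_succ]
    rw [List.getD_eq_getElem _ _ hj', List.getD_eq_getElem _ _ (hij.trans_lt hj')]
    rcases hij.eq_or_lt with rfl | h
    · exact le_rfl
    · exact List.pairwise_iff_getElem.mp (sortedDesc_pairwise s) i j _ _ h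
  · simp only [part_eq_zero hj, zero_le]

theorem psum_eq_sum_part (s : Multiset ℕ) (j : ℕ) :
    psum s j = ∑ i ∈ Finset.range j, part s (i + 1) := by
  induction j with
  | zero => simp [psum]
  | succ j ih =>
    rw [Finset.sum_range_succ, ← ih, psum, psum, part_succ]
    rcases lt_or_ge j (sortedDesc s).length with h | h
    · rw [List.sum_take_succ _ _ h, List.getD_eq_getElem _ _ h]
    · rw [List.take_of_length_le h, List.take_of_length_le (h.trans (Nat.le_succ j)),
        List.getD_eq_default _ _ h, add_zero]

theorem map_part_range (s : Multiset ℕ) :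
    (Multiset.range s.card).map (fun i => part s (i + 1)) = s := by
  conv_rhs => rw [← coe_sortedDesc s]
  rw [← Multiset.coe_range, Multiset.map_coe, Multiset.coe_eq_coe]
  refine List.Perm.of_eq (List.ext_getElem ?_ fun i h₁ h₂ => ?_)
  · simp [length_sortedDesc]
  · simp [part_succ, List.getElem?_eq_getElem h₂]

theorem card_filter_eq {s : Multiset ℕ} {N : ℕ} (hN : s.card ≤ N) (P : ℕ → Prop) [DecidablePred P]
    (hP : ¬ P 0) :
    (s.filter P).card = ((Finset.range N).filter (fun i => P (part s (i + 1)))).card := by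
  conv_lhs => rw [← map_part_range s, Multiset.filter_map, Multiset.card_map]
  change ((Finset.range s.card).filter (fun i => P (part s (i + 1)))).card = _
  congr 1
  ext i
  simp only [Finset.mem_filter, Finset.mem_range]
  refine ⟨fun h => ⟨h.1.trans_le hN, h.2⟩, fun h => ⟨?_, h.2⟩⟩
  by_contra! hi
  exact hP (part_eq_zero hi ▸ h.2)

theorem count_eq {s : Multiset ℕ} {N : ℕ} (hN : s.card ≤ N) {x : ℕ} (hx : x ≠ 0) :
    s.count x = ((Finset.range N).filter (fun i => part s (i + 1) = x)).card := by
  rw [Multiset.count, Multiset.countP_eq_card_filter, card_filter_eq hN _ (by simpa using hx)]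
  simp only [eq_comm]

theorem sum_eq_psum {s : Multiset ℕ} {N : ℕ} (hN : s.card ≤ N) : s.sum = psum s N := by
  rw [psum, List.take_of_length_le (by rwa [length_sortedDesc]), ← Multiset.sum_coe,
    coe_sortedDesc]

theorem part_map_range {h : ℕ → ℕ} (ha : Antitone h) {p : ℕ} (hp : ∀ i, p ≤ i → h i = 0) (i : ℕ) :
    part ((Multiset.range p).map h) (i + 1) = h i := by
  have hs : ((List.range p).map h).Pairwise (· ≥ ·) :=
    List.pairwise_map.mpr (List.pairwise_lt_range.imp fun hab => ha hab.le)
  rw [part_succ, ← Multiset.coe_range, Multiset.map_coe, sortedDesc_coe hs]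
  rcases lt_or_ge i p with hi | hi
  · rw [List.getD_eq_getElem _ _ (by simpa using hi)]
    simp
  · rw [List.getD_eq_default _ _ (by simpa using hi), hp i hi]

theorem part_filter_map_range {h : ℕ → ℕ} (ha : Antitone h) {p : ℕ}
    (hp : ∀ i, p ≤ i → h i = 0) (i : ℕ) :
    part (((Multiset.range p).map h).filter (fun x => 0 < x)) (i + 1) = h i := by
  induction p with
  | zero => simp [part, sortedDesc, hp i (Nat.zero_le i)]
  | succ p ih =>
    rcases Nat.eq_zero_or_pos (h p) with h0 | h0
    · rw [Multiset.range_succ, Multiset.map_cons, Multiset.filter_cons_of_neg _ (by simp [h0])]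
      exact ih fun i hi => Nat.eq_zero_of_le_zero (h0 ▸ ha hi)
    · rw [Multiset.filter_eq_self.mpr, part_map_range ha hp]
      intro x hx
      obtain ⟨j, hj, rfl⟩ := Multiset.mem_map.mp hx
      rw [Multiset.mem_range] at hj
      exact h0.trans_le (ha (Nat.lt_succ_iff.mp hj))

theorem part_mem {s : Multiset ℕ} {i : ℕ} (h : part s (i + 1) ≠ 0) : part s (i + 1) ∈ s := by
  have hi : i < s.card := by
    by_contra! hi
    exact h (part_eq_zero hi)
  have hmem : part s (i + 1) ∈ (Multiset.range s.card).map (fun i => part s (i + 1)) :=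
    Multiset.mem_map.mpr ⟨i, Multiset.mem_range.mpr hi, rfl⟩
  rwa [map_part_range] at hmem

theorem exists_part_eq {s : Multiset ℕ} {x : ℕ} (h : x ∈ s) : ∃ i, part s (i + 1) = x := by
  rw [← map_part_range s] at h
  obtain ⟨i, -, hi⟩ := Multiset.mem_map.mp h
  exact ⟨i, hi⟩

/-- Specialness only depends on the number of even parts above each odd part. -/
theorem isSpecialE_of_even_card {s : Multiset ℕ}
    (h : ∀ q ∈ s, Odd q → Even (s.filter (fun x => Even x ∧ q < x)).card) : IsSpecialE s := by
  have key : ∀ t, OddIdx s t → Even (eCount s 1 t) := by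
    rintro t ⟨ht, hodd⟩
    obtain ⟨t, rfl⟩ := Nat.exists_eq_add_of_le' ht
    have hmem := part_mem (s := s) (i := t) hodd.pos.ne'
    have hE := h _ hmem hodd
    rw [card_filter_eq (le_max_left s.card (t + 1)) _ (by simp)] at hE
    convert hE using 1
    rw [eCount]
    refine Finset.card_bij (fun k _ => k - 1) ?_ ?_ ?_
    · intro k hk
      simp only [Finset.mem_filter, Finset.mem_Icc, Finset.mem_range] at hk ⊢
      obtain ⟨⟨hk1, hkt⟩, hke⟩ := hk
      obtain ⟨k, rfl⟩ := Nat.exists_eq_add_of_le' hk1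
      have hle : part s (t + 1) ≤ part s (k + 1) := antitone_part s (by omega)
      refine ⟨by simp; omega, hke, lt_of_le_of_ne hle fun heq => ?_⟩
      exact Nat.not_even_iff_odd.mpr hodd (heq ▸ hke)
    · intro a ha b hb hab
      simp only [Finset.mem_filter, Finset.mem_Icc] at ha hb
      omega
    · intro k hk
      simp only [Finset.mem_filter, Finset.mem_range] at hk
      refine ⟨k + 1, ?_, rfl⟩
      simp only [Finset.mem_filter, Finset.mem_Icc]
      refine ⟨⟨by omega, ?_⟩, hk.2.1⟩
      by_contra! hlt
      exact absurd (antitone_part s (by omega : t ≤ k)) (not_le.mpr hk.2.2)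
  refine ⟨fun t ht _ => key t ht, fun i j hi hj hij _ => ?_⟩
  have hsplit : eCount s 1 j = eCount s 1 i + eCount s i j := by
    have hI : (Finset.Icc 1 j).filter (fun k => Even (part s k)) =
        (Finset.Icc 1 i).filter (fun k => Even (part s k)) ∪
        (Finset.Icc i j).filter (fun k => Even (part s k)) := by
      have := hi.1
      rw [← Finset.filter_union]
      congr 1
      ext k
      simp only [Finset.mem_union, Finset.mem_Icc]
      omega
    rw [eCount, eCount, eCount, hI, Finset.card_union_of_disjoint]
    rw [Finset.disjoint_left]
    intro k hk hk'
    simp only [Finset.mem_filter, Finset.mem_Icc] at hk hk'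
    obtain rfl : k = i := by omega
    exact Nat.not_even_iff_odd.mpr hi.2 hk.2
  have h1 := key j hj
  rw [hsplit, Nat.even_add] at h1
  exact h1.mp (key i hi)

theorem even_card_filter_pairs {P : ℕ → Prop} [DecidablePred P]
    (h : ∀ i, P (2 * i) ↔ P (2 * i + 1)) (M : ℕ) :
    Even ((Finset.range (2 * M)).filter P).card := by
  simp only [Finset.card_filter]
  induction M with
  | zero => simp
  | succ M ih =>
    rw [show 2 * (M + 1) = 2 * M + 1 + 1 by ring, Finset.sum_range_succ, Finset.sum_range_succ]
    simp only [← h M, add_assoc]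
    exact ih.add ⟨_, rfl⟩

theorem even_card_of_even_count {s : Multiset ℕ} (h : ∀ x, Even (s.count x)) : Even s.card := by
  rw [← Multiset.toFinset_sum_count_eq]
  exact Finset.even_sum _ fun x _ => h x

/-- In a C-partition, a partial sum is odd only inside a block of equal odd parts. -/
theorem IsTypeC.part_eq_of_odd_psum {s : Multiset ℕ} (hs : IsTypeC s) {j : ℕ}
    (hj : Odd (psum s (j + 1))) :
    Odd (part s (j + 1)) ∧ part s (j + 1) = part s (j + 1 + 1) := by
  by_contra hcon
  refine Nat.not_even_iff_odd.mpr hj ?_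
  rw [psum_eq_sum_part]
  have ha := antitone_part s
  have hcomp := Finset.sum_comp (s := Finset.range (j + 1)) (fun x : ℕ => x)
    (fun i => part s (i + 1))
  rw [hcomp]
  refine Finset.even_sum _ fun x hx => ?_
  rw [smul_eq_mul]
  rcases Nat.even_or_odd x with hxe | hxo
  · exact hxe.mul_left _
  · refine Even.mul_right ?_ _
    have hc := hs.2.2 x hxo
    rw [count_eq (le_max_left s.card (j + 1)) hxo.pos.ne'] at hc
    refine (congrArg Even (congrArg Finset.card (Finset.ext fun i => ?_))).mpr hc
    simp only [Finset.mem_filter, Finset.mem_range]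
    refine ⟨fun h => ⟨by omega, h.2⟩, fun h => ⟨?_, h.2⟩⟩
    by_contra! hi
    obtain ⟨k, hk, rfl⟩ := Finset.mem_image.mp hx
    rw [Finset.mem_range] at hk
    have h1 : part s (j + 1) ≤ part s (k + 1) := ha (by omega)
    have h2 : part s (j + 1 + 1) ≤ part s (j + 1) := ha (by omega)
    have h3 : part s (i + 1) ≤ part s (j + 1 + 1) := ha (by omega)
    have h4 := h.2
    have h5 : part s (j + 1) = part s (k + 1) := by omega
    exact hcon ⟨h5 ▸ hxo, by omega⟩

theorem count_muEven (T : Multiset ℕ) (x : ℕ) :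
    (muEven T).count x = if Even x ∧ x ∈ T then (if Even (T.count x) then 2 else 1) else 0 := by
  rw [muEven, Multiset.count_bind]
  simp only [Multiset.count_replicate]
  change (∑ y ∈ T.toFinset.filter (fun x => Even x), _) = _
  rw [Finset.sum_ite_eq']
  simp [and_comm]

/-- The amount by which the collapse lowers the sum of the first `j` values of `g`. -/
def collapseDefect (g : ℕ → ℕ) (j : ℕ) : ℕ :=
  if j = 0 then 0 else if Even (g (j - 1)) ∨ (Odd j ∧ g (j - 1) ≠ g j) then 1 else 0

/-- The values of the C-collapse of `λ⁻`, where `g` lists the parts of `λ`, a partition with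
odd first part whose following parts come in pairs of equal parity. -/
def collapseFun (g : ℕ → ℕ) (j : ℕ) : ℕ :=
  if Even (g j) then g j
  else g j + (if Odd j ∧ g (j - 1) ≠ g j then 1 else 0) -
    (if Even j ∧ g j ≠ g (j + 1) then 1 else 0)

section Collapse

variable {g : ℕ → ℕ}

theorem collapseFun_of_even {j : ℕ} (h : Even (g j)) : collapseFun g j = g j := if_pos h

theorem collapseFun_of_odd {j : ℕ} (h : Odd (collapseFun g j)) : collapseFun g j = g j := by
  unfold collapseFun at *
  grind

theorem collapseFun_pair (g : ℕ → ℕ) (i : ℕ) :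
    collapseFun g (2 * i) = collapseFun g (2 * i + 1) ∨
      (Even (collapseFun g (2 * i)) ∧ Even (collapseFun g (2 * i + 1))) := by
  have h1 : Even (2 * i) := even_two_mul i
  have h2 : ¬ Odd (2 * i) := Nat.not_odd_iff_even.mpr h1
  have h3 : Odd (2 * i + 1) := odd_two_mul_add_one i
  have h4 : ¬ Even (2 * i + 1) := Nat.not_even_iff_odd.mpr h3
  simp only [collapseFun, h1, h2, h3, h4, Nat.add_sub_cancel]
  grind

theorem antitone_collapseFun (ha : Antitone g) : Antitone (collapseFun g) := by
  refine antitone_nat_of_succ_le fun j => ?_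
  have h := ha (Nat.le_succ j)
  have h' := ha (Nat.le_succ (j + 1))
  simp only [Nat.succ_eq_add_one] at h h'
  simp only [collapseFun, Nat.add_sub_cancel]
  grind

theorem collapseFun_add_defect (hg0 : Odd (g 0))
    (hpair : ∀ j, Odd j → (Even (g j) ↔ Even (g (j + 1)))) (j : ℕ) :
    collapseFun g j + collapseDefect g (j + 1) = g j + collapseDefect g j := by
  cases j with
  | zero =>
    simp only [collapseFun, collapseDefect]
    grind
  | succ j =>
    have := hpair j
    simp only [collapseFun, collapseDefect, Nat.add_sub_cancel]
    grind

theorem sum_collapseFun (hg0 : Odd (g 0))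
    (hpair : ∀ j, Odd j → (Even (g j) ↔ Even (g (j + 1)))) (j : ℕ) :
    ∑ i ∈ Finset.range j, collapseFun g i + collapseDefect g j = ∑ i ∈ Finset.range j, g i := by
  induction j with
  | zero => simp [collapseDefect]
  | succ j ih =>
    have := collapseFun_add_defect hg0 hpair j
    rw [Finset.sum_range_succ, Finset.sum_range_succ]
    omega

theorem odd_sum_range (hg0 : Odd (g 0))
    (hpair : ∀ j, Odd j → (Even (g j) ↔ Even (g (j + 1)))) (m : ℕ) :
    Odd (∑ i ∈ Finset.range (2 * m + 1), g i) := by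
  induction m with
  | zero => simpa using hg0
  | succ m ih =>
    rw [show 2 * (m + 1) + 1 = 2 * m + 1 + 1 + 1 by ring, Finset.sum_range_succ,
      Finset.sum_range_succ, add_assoc]
    exact ih.add_even (Nat.even_add.mpr (hpair _ (odd_two_mul_add_one m)))

theorem odd_sum_of_defect (hg0 : Odd (g 0))
    (hpair : ∀ j, Odd j → (Even (g j) ↔ Even (g (j + 1)))) {j : ℕ}
    (h : collapseDefect g (j + 1) = 1) : Odd (∑ i ∈ Finset.range (j + 1), g i) := by
  rcases Nat.even_or_odd' j with ⟨m, rfl | rfl⟩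
  · exact odd_sum_range hg0 hpair m
  · have hodd : Odd (2 * m + 1) := odd_two_mul_add_one m
    rw [Finset.sum_range_succ]
    refine (odd_sum_range hg0 hpair m).add_even ?_
    simp only [collapseDefect, Nat.add_sub_cancel] at h
    grind

theorem defect_le_one (g : ℕ → ℕ) (j : ℕ) : collapseDefect g j ≤ 1 := by
  unfold collapseDefect
  split_ifs <;> omega

theorem defect_eq_one (hpair : ∀ j, Odd j → (Even (g j) ↔ Even (g (j + 1)))) {j : ℕ}
    (h : g (j + 1) = 0) : collapseDefect g (j + 1) = 1 := by
  have := hpair j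
  simp only [collapseDefect, Nat.add_sub_cancel, h]
  grind

/-- The multiset of nonzero values of an antitone function vanishing from `p` on, with its parts
and its cardinality. -/
theorem exists_multiset_part {h : ℕ → ℕ} (ha : Antitone h) {p : ℕ} (hp : ∀ i, p ≤ i → h i = 0) :
    ∃ s : Multiset ℕ, PosParts s ∧ s.card ≤ p ∧ ∀ i, part s (i + 1) = h i :=
  ⟨_, fun _ hx => (Multiset.mem_filter.mp hx).2,
    (Multiset.card_le_card (Multiset.filter_le _ _)).trans (by simp),
    part_filter_map_range ha hp⟩

theorem isTypeC_of_part_eq_collapseFun {s : Multiset ℕ} (hs : PosParts s)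
    (hpart : ∀ i, part s (i + 1) = collapseFun g i) : IsTypeC s := by
  have hN : s.card ≤ 2 * s.card := by omega
  refine ⟨hs, ?_, fun x hx => ?_⟩
  · rw [sum_eq_psum hN, psum_eq_sum_part]
    generalize s.card = M
    induction M with
    | zero => simp
    | succ M ih =>
      rw [show 2 * (M + 1) = 2 * M + 1 + 1 by ring, Finset.sum_range_succ, Finset.sum_range_succ,
        hpart, hpart, add_assoc]
      refine ih.add (Nat.even_add.mpr ?_)
      rcases collapseFun_pair g M with h | h
      · rw [h]
      · simp [h.1, h.2]
  · rw [count_eq hN hx.pos.ne']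
    refine even_card_filter_pairs (fun i => ?_) _
    rw [hpart, hpart]
    rcases collapseFun_pair g i with h | h
    · rw [h]
    · grind

/-- The collapse of a partition with partial sums `∑ i < j, g i - [p ≤ j]`. -/
theorem part_collapse (ha : Antitone g) (hg0 : Odd (g 0))
    (hpair : ∀ j, Odd j → (Even (g j) ↔ Even (g (j + 1)))) {p : ℕ}
    (hp : ∀ i, p ≤ i → g i = 0) {α d : Multiset ℕ}
    (hα : ∀ j, psum α j + (if p ≤ j then 1 else 0) = ∑ i ∈ Finset.range j, g i)
    (hd : IsCollapse IsTypeC α d) (i : ℕ) : part d (i + 1) = collapseFun g i := by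
  have hp0 : 0 < p := by
    by_contra! h0
    exact hg0.pos.ne' (hp 0 h0)
  have hc : ∀ i, p ≤ i → collapseFun g i = 0 := fun i hi => by
    rw [collapseFun_of_even (by simp [hp i hi]), hp i hi]
  obtain ⟨b, hbpos, hbcard, hb⟩ := exists_multiset_part (antitone_collapseFun ha) hc
  have hsum := sum_collapseFun hg0 hpair
  have hbsum : ∀ j, psum b j + collapseDefect g j = ∑ i ∈ Finset.range j, g i := fun j => by
    rw [← hsum j, psum_eq_sum_part]
    simp only [hb]
  have hone : ∀ j, p ≤ j → collapseDefect g j = 1 := fun j hj => by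
    obtain ⟨j, rfl⟩ := Nat.exists_eq_add_of_le' (hp0.trans_le hj)
    exact defect_eq_one hpair (hp _ hj)
  obtain ⟨hdC, hdsum, hdle, hdmax⟩ := hd
  have hle : DomLE b d := by
    refine hdmax b (isTypeC_of_part_eq_collapseFun hbpos hb) ?_ ?_
    · set N := max p α.card
      rw [sum_eq_psum (hbcard.trans (by omega) : b.card ≤ N), sum_eq_psum (by omega : α.card ≤ N)]
      have h1 := hbsum N
      have h2 := hα N
      rw [hone N (by omega)] at h1
      rw [if_pos (by omega)] at h2
      omega
    · intro j
      have h1 := hbsum j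
      have h2 := hα j
      split_ifs at h2 with hj
      · rw [hone j hj] at h1
        omega
      · omega
  have hge : DomLE d b := by
    intro j
    have h1 := hbsum j
    have h2 := hα j
    have h3 := hdle j
    have h4 := defect_le_one g j
    by_contra! hlt
    have h5 : collapseDefect g j = 1 := by omega
    have h6 : ¬ p ≤ j := fun h => by rw [if_pos h] at h2; omega
    rw [if_neg h6] at h2
    cases j with
    | zero => simp [collapseDefect] at h5
    | succ j =>
      have hodd := odd_sum_of_defect hg0 hpair h5
      rw [show ∑ i ∈ Finset.range (j + 1), g i = psum d (j + 1) by omega] at hodd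
      obtain ⟨ho, heq⟩ := hdC.part_eq_of_odd_psum hodd
      have k1 := hdle j
      have k2 := hα j
      have k3 := hdle (j + 1 + 1)
      have k4 := hα (j + 1 + 1)
      rw [psum_eq_sum_part d, Finset.sum_range_succ] at k3 h3
      rw [Finset.sum_range_succ] at k4
      rw [psum_eq_sum_part d, Finset.sum_range_succ] at hlt
      rw [psum_eq_sum_part d] at k1
      rw [Finset.sum_range_succ] at k3
      rw [Finset.sum_range_succ] at k4 h2 h1
      have k5 := ha (Nat.le_succ j)
      simp only [Nat.succ_eq_add_one] at k5
      have k6 : part d (j + 1) = g j := by omega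
      have k7 : g j = g (j + 1) := by omega
      rw [k6] at ho
      simp only [collapseDefect, Nat.add_sub_cancel] at h5
      grind
  have hpsum : ∀ j, psum d j = psum b j := fun j => le_antisymm (hge j) (hle j)
  have h1 := hpsum (i + 1)
  have h2 := hpsum i
  rw [psum_eq_sum_part, psum_eq_sum_part, Finset.sum_range_succ, Finset.sum_range_succ,
    ← psum_eq_sum_part, ← psum_eq_sum_part] at h1
  rw [← hb]
  omega

end Collapse

theorem minPart_eq {s : Multiset ℕ} {m : ℕ} (hm : m ∈ s) (h : ∀ x ∈ s, m ≤ x) : minPart s = m := by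
  obtain ⟨t, rfl⟩ := Multiset.exists_cons_of_mem hm
  rw [minPart, Multiset.sort_cons _ _ _ fun b hb => h b (Multiset.mem_cons_of_mem hb)]
  rfl

theorem antitone_card_filter_le (l : Multiset ℕ) :
    Antitone (fun j => (l.filter (fun x => j + 1 ≤ x)).card) := fun _ _ hij =>
  Multiset.card_le_card (Multiset.monotone_filter_right _ fun _ hx => by omega)

theorem card_filter_le_eq_zero {l : Multiset ℕ} {i : ℕ} (hi : part l 1 ≤ i) :
    (l.filter (fun x => i + 1 ≤ x)).card = 0 := by
  rw [Multiset.card_eq_zero, Multiset.filter_eq_nil]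
  intro x hx hix
  obtain ⟨k, rfl⟩ := exists_part_eq hx
  have : part l (k + 1) ≤ part l (0 + 1) := antitone_part l (Nat.zero_le k)
  rw [zero_add] at this
  omega

theorem card_filter_le_pos {l : Multiset ℕ} {i : ℕ} (hi : i < part l 1) :
    0 < (l.filter (fun x => i + 1 ≤ x)).card := by
  rw [Multiset.card_pos_iff_exists_mem]
  refine ⟨part l (0 + 1), Multiset.mem_filter.mpr ⟨part_mem ?_, ?_⟩⟩ <;> rw [zero_add] <;> omega

theorem card_filter_le_succ (l : Multiset ℕ) (i : ℕ) :
    (l.filter (fun x => i + 1 ≤ x)).card =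
      (l.filter (fun x => i + 1 + 1 ≤ x)).card + l.count (i + 1) := by
  rw [Multiset.count, Multiset.countP_eq_card_filter, ← Multiset.card_add,
    Multiset.filter_add_filter]
  have h : l.filter (fun x => i + 1 + 1 ≤ x ∧ i + 1 = x) = 0 :=
    Multiset.filter_eq_nil.mpr fun x _ hx => by omega
  rw [h, add_zero]
  congr 1
  exact Multiset.filter_congr fun x _ => by omega

theorem IsTypeB.odd_card {l : Multiset ℕ} (h : IsTypeB l) : Odd l.card := by
  have hs := h.2.1
  rw [Finset.sum_multiset_count] at hs
  rw [← Multiset.toFinset_sum_count_eq]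
  rw [Finset.odd_sum_iff_odd_card_odd] at hs ⊢
  have hiff : ∀ x, Odd (l.count x • x) ↔ Odd (l.count x) := fun x => by
    have := h.2.2 x
    rw [smul_eq_mul, Nat.odd_mul]
    grind
  simpa only [hiff] using hs

/-- Partial sums of `T⁻` for `T` the multiset of positive values of an antitone function. -/
theorem psum_decMin {g : ℕ → ℕ} (ha : Antitone g) {p : ℕ} (hp : ∀ i, p + 1 ≤ i → g i = 0)
    (hpos : 0 < g p) (j : ℕ) :
    psum (decMin ((Multiset.range (p + 1)).map g)) j + (if p + 1 ≤ j then 1 else 0) =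
      ∑ i ∈ Finset.range j, g i := by
  set h : ℕ → ℕ := fun i => g i - if i = p then 1 else 0 with hh
  have hha : Antitone h := by
    refine antitone_nat_of_succ_le fun i => ?_
    have h1 : g (i + 1) ≤ g i := ha (Nat.le_succ i)
    simp only [hh]
    split_ifs with h2 h3 h3
    · omega
    · omega
    · simp [hp (i + 1) (by omega)]
    · exact h1
  have hmin : minPart ((Multiset.range (p + 1)).map g) = g p := by
    refine minPart_eq (Multiset.mem_map_of_mem g (by simp)) fun x hx => ?_
    obtain ⟨i, hi, rfl⟩ := Multiset.mem_map.mp hx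
    rw [Multiset.mem_range] at hi
    exact ha (by omega)
  have hdec : decMin ((Multiset.range (p + 1)).map g) =
      ((Multiset.range (p + 1)).map h).filter (fun x => 0 < x) := by
    rw [decMin, hmin, Multiset.range_succ, Multiset.map_cons, Multiset.erase_cons_head,
      Multiset.map_cons]
    congr 2
    · simp [hh]
    · refine Multiset.map_congr rfl fun i hi => ?_
      rw [Multiset.mem_range] at hi
      simp [hh, hi.ne]
  have hh0 : ∀ i, p + 1 ≤ i → h i = 0 := fun i hi => by simp [hh, hp i hi]
  rw [hdec, psum_eq_sum_part]
  simp only [part_filter_map_range hha hh0]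
  have hg : ∀ i, g i = h i + if i = p then 1 else 0 := fun i => by
    simp only [hh]
    split_ifs with hi
    · subst hi
      omega
    · rfl
  simp only [hg, Finset.sum_add_distrib, Finset.sum_ite_eq', Finset.mem_range, Nat.succ_le_iff]

theorem isTypeC_of_even {s : Multiset ℕ} (hpos : PosParts s) (h : ∀ x ∈ s, Even x) :
    IsTypeC s := by
  refine ⟨hpos, ?_, fun x hx => ?_⟩
  · rw [even_iff_two_dvd]
    exact Multiset.dvd_sum fun x hx => even_iff_two_dvd.mp (h x hx)
  · rw [Multiset.count_eq_zero_of_notMem fun hm => Nat.not_even_iff_odd.mpr hx (h x hm)]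
    exact Even.zero

theorem even_of_mem_muEven {T : Multiset ℕ} {x : ℕ} (h : x ∈ muEven T) : Even x ∧ x ∈ T := by
  rw [← Multiset.one_le_count_iff_mem, count_muEven] at h
  by_contra hx
  rw [if_neg hx] at h
  omega

theorem count_muEven_le (T : Multiset ℕ) (x : ℕ) : (muEven T).count x ≤ T.count x := by
  rw [count_muEven]
  split_ifs with h h1
  · have := Multiset.one_le_count_iff_mem.mpr h.2
    grind
  · exact Multiset.one_le_count_iff_mem.mpr h.2
  · exact Nat.zero_le _

theorem even_count_muEven_add (T : Multiset ℕ) {x : ℕ} (hx : Even x) :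
    Even ((muEven T).count x + T.count x) := by
  rw [count_muEven]
  have : x ∉ T → T.count x = 0 := Multiset.count_eq_zero_of_notMem
  grind

/-- For a B-partition `λ` of `n ≥ 1` with `d(λ) = ((λᵗ)⁻)_C`, one
has `μ(λ) ⊆ d(λ)`, and both `μ(λ)` and `d(λ) ∖ μ(λ)` are special C-partitions
(specialness in the e-count sense). -/
theorem statement4 (n : ℕ) (hn : 1 ≤ n) (l : Multiset ℕ)
    (hB : IsTypeB l ∧ l.sum = 2 * n + 1)
    (d : Multiset ℕ) (hd : IsCollapse IsTypeC (decMin (transpose l)) d) :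
    muEven (transpose l) ≤ d ∧
    (IsTypeC (muEven (transpose l)) ∧ IsSpecialE (muEven (transpose l))) ∧
    (IsTypeC (d - muEven (transpose l)) ∧ IsSpecialE (d - muEven (transpose l))) := by
  obtain ⟨hB, -⟩ := hB
  set g : ℕ → ℕ := fun j => (l.filter (fun x => j + 1 ≤ x)).card with hg
  have ha : Antitone g := antitone_card_filter_le l
  have hg0 : Odd (g 0) := by
    have h : l.filter (fun x => 0 + 1 ≤ x) = l := Multiset.filter_eq_self.mpr fun x hx => hB.1 x hx
    simp only [hg, h]
    exact hB.odd_card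
  have hpair : ∀ j, Odd j → (Even (g j) ↔ Even (g (j + 1))) := fun j hj => by
    have hc := hB.2.2 (j + 1) hj.add_one
    rw [show g j = g (j + 1) + l.count (j + 1) from card_filter_le_succ l j, Nat.even_add]
    simp [hc]
  have hp : ∀ i, part l 1 ≤ i → g i = 0 := fun i hi => card_filter_le_eq_zero hi
  set T := transpose l with hT
  have hTpos : PosParts T := fun x hx => by
    obtain ⟨i, hi, rfl⟩ := Multiset.mem_map.mp hx
    exact card_filter_le_pos (Multiset.mem_range.mp hi)
  have hTpart : ∀ i, part T (i + 1) = g i := part_map_range ha hp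
  have hpart : ∀ i, part d (i + 1) = collapseFun g i := by
    refine part_collapse ha hg0 hpair hp (fun j => ?_) hd
    obtain ⟨p, hp'⟩ : ∃ p, part l 1 = p + 1 := Nat.exists_eq_succ_of_ne_zero fun h =>
      hg0.pos.ne' (hp 0 h.le)
    have hpos : 0 < g p := card_filter_le_pos (by omega)
    rw [hT, transpose, hp']
    exact psum_decMin ha (fun i hi => hp i (hp'.trans_le hi)) hpos j
  have hdC := hd.1
  have hle : muEven T ≤ d := by
    refine Multiset.le_iff_count.mpr fun x => ?_
    by_cases hx : x ∈ muEven T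
    · obtain ⟨hxe, hxT⟩ := even_of_mem_muEven hx
      refine (count_muEven_le T x).trans ?_
      have hx0 := (hTpos x hxT).ne'
      rw [count_eq (le_max_left T.card d.card) hx0, count_eq (le_max_right T.card d.card) hx0]
      refine Finset.card_le_card fun i hi => ?_
      rw [Finset.mem_filter, hTpart] at hi
      rw [Finset.mem_filter, hpart, collapseFun_of_even (hi.2 ▸ hxe)]
      exact hi
    · rw [Multiset.count_eq_zero_of_notMem hx]
      exact Nat.zero_le _
  have hmuC : IsTypeC (muEven T) := isTypeC_of_even
    (fun x hx => hTpos x (even_of_mem_muEven hx).2) fun x hx => (even_of_mem_muEven hx).1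
  have hadd : d - muEven T + muEven T = d := tsub_add_cancel_of_le hle
  refine ⟨hle, ⟨hmuC, isSpecialE_of_even_card fun q hq hqo =>
    absurd (even_of_mem_muEven hq).1 (Nat.not_even_iff_odd.mpr hqo)⟩, ⟨?_, ?_, ?_⟩, ?_⟩
  · exact fun x hx => hdC.1 x (Multiset.mem_of_le (Multiset.sub_le_self _ _) hx)
  · have h := hdC.2.1
    rw [← hadd, Multiset.sum_add, Nat.even_add] at h
    exact h.mpr hmuC.2.1
  · intro x hx
    have h := hdC.2.2 x hx
    rw [← hadd, Multiset.count_add, Nat.even_add] at h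
    exact h.mpr (hmuC.2.2 x hx)
  · refine isSpecialE_of_even_card fun q hq hqo => ?_
    obtain ⟨k, hk⟩ := exists_part_eq (Multiset.mem_of_le (Multiset.sub_le_self _ _) hq)
    rw [hpart] at hk
    have hgk : g k = q := by rw [← hk, collapseFun_of_odd (hk ▸ hqo)]
    have hac := antitone_collapseFun ha
    have hd_even : Even (d.filter (fun x => Even x ∧ q < x)).card := by
      rw [card_filter_eq (by omega : d.card ≤ 2 * d.card) _ (by simp)]
      refine even_card_filter_pairs (fun i => ?_) _
      rw [hpart, hpart]
      rcases collapseFun_pair g i with h | ⟨h, h'⟩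
      · rw [h]
      · have h1 : k ≤ 2 * i → collapseFun g (2 * i) ≤ q := fun hi => hk ▸ hac hi
        have h2 : 2 * i + 1 ≤ k → q ≤ collapseFun g (2 * i + 1) := fun hi => hk ▸ hac hi
        have h3 := hac (Nat.le_succ (2 * i))
        simp only [Nat.succ_eq_add_one] at h3
        grind
    have hT_even : Even (T.filter (fun x => Even x ∧ q < x)).card := by
      rw [card_filter_eq (by omega : T.card ≤ 2 * T.card + 1) _ (by simp), Finset.card_filter,
        Finset.sum_range_succ', ← Finset.card_filter, hTpart,
        if_neg fun h => Nat.not_even_iff_odd.mpr hg0 h.1, add_zero]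
      refine even_card_filter_pairs (fun i => ?_) _
      rw [hTpart, hTpart]
      have h0 := hpair (2 * i + 1) (odd_two_mul_add_one i)
      have h1 : k ≤ 2 * i + 1 → g (2 * i + 1) ≤ q := fun hi => hgk ▸ ha hi
      have h2 : 2 * i + 1 + 1 ≤ k → q ≤ g (2 * i + 1 + 1) := fun hi => hgk ▸ ha hi
      have h3 := ha (Nat.le_succ (2 * i + 1))
      simp only [Nat.succ_eq_add_one] at h3
      grind
    have hsum : Even ((muEven T + T).filter (fun x => Even x ∧ q < x)).card := by
      refine even_card_of_even_count fun x => ?_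
      rw [Multiset.count_filter]
      split_ifs with hx
      · rw [Multiset.count_add]
        exact even_count_muEven_add T hx.1
      · exact Even.zero
    rw [Multiset.filter_add, Multiset.card_add, Nat.even_add] at hsum
    rw [← hadd, Multiset.filter_add, Multiset.card_add, Nat.even_add] at hd_even
    exact hd_even.mpr (hsum.mpr hT_even)

end WFPaper
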